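/- arXiv:2308.12917 — 9 statements merged into one kernel-verified Lean document; each statement's English description precedes it below -/
import Mathlib

section
/- Suppose each payoff function f_i : (ℝ^n)^N → ℝ is twice continuously differentiable. Then there exists a differentiable function φ : (ℝ^n)^N → ℝ with ∂φ/∂a_{im} = ∂f_i/∂a_{im} at every point, for all i ∈ {1,…,N} and m ∈ {1,…,n}, if and only if ∂²f_i/(∂a_{ip}∂a_{jq}) = ∂²f_j/(∂a_{jq}∂a_{ip}) at every point, for all i, j ∈ {1,…,N} and all p, q ∈ {1,…,n}. -/
/-- Two continuous linear maps on `(ℝ^n)^N` agreeing on the coordinate vectors are equal. -/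
theorem clm_ext_single {N n : ℕ} {F : Type*} [NormedAddCommGroup F] [NormedSpace ℝ F]
    {A B : (Fin N → Fin n → ℝ) →L[ℝ] F}
    (h : ∀ (i : Fin N) (m : Fin n), A (Pi.single i (Pi.single m 1)) =
      B (Pi.single i (Pi.single m 1))) : A = B := by
  apply ContinuousLinearMap.coe_injective
  apply LinearMap.pi_ext'
  intro i
  apply LinearMap.pi_ext'
  intro m
  apply LinearMap.ext_ring
  exact h i m

/-- The differential form `∑ ∂f_i/∂a_{im} da_{im}`. -/
noncomputable def gameForm {N n : ℕ} (f : Fin N → (Fin N → Fin n → ℝ) → ℝ)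
    (x : Fin N → Fin n → ℝ) : (Fin N → Fin n → ℝ) →L[ℝ] ℝ :=
  ∑ i, ∑ m, (fderiv ℝ (f i) x (Pi.single i (Pi.single m 1))) •
    ((ContinuousLinearMap.proj (R := ℝ) (φ := fun _ : Fin n => ℝ) m).comp
      (ContinuousLinearMap.proj (R := ℝ) (φ := fun _ : Fin N => Fin n → ℝ) i))

theorem gameForm_single {N n : ℕ} (f : Fin N → (Fin N → Fin n → ℝ) → ℝ)
    (x : Fin N → Fin n → ℝ) (i : Fin N) (m : Fin n) :
    gameForm f x (Pi.single i (Pi.single m 1)) =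
      fderiv ℝ (f i) x (Pi.single i (Pi.single m 1)) := by
  simp only [gameForm, _root_.sum_apply, _root_.smul_apply,
    ContinuousLinearMap.comp_apply, ContinuousLinearMap.proj_apply, smul_eq_mul]
  rw [Finset.sum_eq_single i, Finset.sum_eq_single m]
  · simp
  · intro b _ hb
    simp [hb]
  · simp
  · intro b _ hb
    simp [hb]
  · simp

theorem gameForm_differentiable {N n : ℕ} (f : Fin N → (Fin N → Fin n → ℝ) → ℝ)
    (hf : ∀ i, ContDiff ℝ 2 (f i)) : Differentiable ℝ (gameForm f) := by
  unfold gameForm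
  have h : ∀ i, Differentiable ℝ (fderiv ℝ (f i)) := fun i =>
    ((hf i).fderiv_right (m := 1) (by norm_num)).differentiable (by norm_num)
  refine Differentiable.fun_sum fun i _ => Differentiable.fun_sum fun m _ => ?_
  exact ((h i).clm_apply (differentiable_const _)).smul_const _

theorem fderiv_gameForm_single {N n : ℕ} (f : Fin N → (Fin N → Fin n → ℝ) → ℝ)
    (hf : ∀ i, ContDiff ℝ 2 (f i)) (x v : Fin N → Fin n → ℝ) (i : Fin N) (p : Fin n) :
    fderiv ℝ (fun y => fderiv ℝ (f i) y (Pi.single i (Pi.single p 1))) x v =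
      fderiv ℝ (gameForm f) x v (Pi.single i (Pi.single p 1)) := by
  simp only [← gameForm_single]
  rw [fderiv_clm_apply (gameForm_differentiable f hf x) (differentiableAt_const _)]
  simp

/-- For `C²` payoffs `f i : (ℝ^n)^N → ℝ`, there is a differentiable
`φ : (ℝ^n)^N → ℝ` with `∂φ/∂a_{im} = ∂f_i/∂a_{im}` everywhere (for all players `i` and
coordinates `m`) iff `∂²f_i/(∂a_{ip}∂a_{jq}) = ∂²f_j/(∂a_{jq}∂a_{ip})` everywhere, for all
players `i, j` and coordinates `p, q`. -/
theorem potential_iff_cross_partials {N n : ℕ}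
    (f : Fin N → (Fin N → Fin n → ℝ) → ℝ)
    (hf : ∀ i, ContDiff ℝ 2 (f i)) :
    (∃ φ : (Fin N → Fin n → ℝ) → ℝ, Differentiable ℝ φ ∧
        ∀ (i : Fin N) (m : Fin n) (x : Fin N → Fin n → ℝ),
          fderiv ℝ φ x (Pi.single i (Pi.single m 1)) =
            fderiv ℝ (f i) x (Pi.single i (Pi.single m 1))) ↔
    (∀ (i j : Fin N) (p q : Fin n) (x : Fin N → Fin n → ℝ),
        fderiv ℝ (fun y => fderiv ℝ (f i) y (Pi.single i (Pi.single p 1))) x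
            (Pi.single j (Pi.single q 1)) =
          fderiv ℝ (fun y => fderiv ℝ (f j) y (Pi.single j (Pi.single q 1))) x
            (Pi.single i (Pi.single p 1))) := by
  simp only [fderiv_gameForm_single f hf]
  simp only [← gameForm_single]
  constructor
  · rintro ⟨φ, hφ, h⟩ i j p q x
    have hd : ∀ y, HasFDerivAt φ (gameForm f y) y := by
      intro y
      have e : fderiv ℝ φ y = gameForm f y := clm_ext_single fun i m => h i m y
      rw [← e]
      exact (hφ y).hasFDerivAt
    exact second_derivative_symmetric hd (gameForm_differentiable f hf x).hasFDerivAt _ _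
  · intro h
    obtain ⟨φ, hφ⟩ := (convex_univ (𝕜 := ℝ) (E := Fin N → Fin n → ℝ)
      ).exists_forall_hasFDerivAt_of_fderiv_symmetric (ω := gameForm f) isOpen_univ
      (gameForm_differentiable f hf).differentiableOn (by
        intro a _ x y
        have e : fderiv ℝ (gameForm f) a = (fderiv ℝ (gameForm f) a).flip := by
          refine clm_ext_single fun j q => clm_ext_single fun i p => ?_
          rw [ContinuousLinearMap.flip_apply]
          exact h i j p q a
        conv_lhs => rw [e]
        rfl)
    refine ⟨φ, fun x => (hφ x trivial).differentiableAt, fun i m x => ?_⟩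
    rw [(hφ x trivial).fderiv]
end

section
/- Consider an N-player aggregative game with N ≥ 2 and payoffs f_i : (ℝ^n)^N → ℝ. If h_P(z, 0) = 0 for every z ∈ (ℝ^n)^N, then player N's payoff is independent of player N's own action, i.e., f_N(x_N, x_{-N}) = f_N(0, x_{-N}) for every joint action x (so the game is abnormal). Equivalently, in an aggregative game in which player N's payoff genuinely depends on x_N (the game is not abnormal via player N), the function z ↦ h_P(z, 0) is not identically zero. -/
noncomputable section

/-- `φ` is a potential function for the `N`-player game with payoffs `f i : (ℝ^n)^N → ℝ`:
for every player `i`, joint action `x` and deviation `x'_i`,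
`f_i(x'_i, x_{-i}) - f_i(x_i, x_{-i}) = φ(x'_i, x_{-i}) - φ(x_i, x_{-i})`. -/
def PotentialFn {N n : ℕ} (f : Fin N → (Fin N → Fin n → ℝ) → ℝ)
    (φ : (Fin N → Fin n → ℝ) → ℝ) : Prop :=
  ∀ (i : Fin N) (x : Fin N → Fin n → ℝ) (x' : Fin n → ℝ),
    f i (Function.update x i x') - f i x = φ (Function.update x i x') - φ x

/-- `pad y m` is the joint action `(y_1, …, y_m, 0, …, 0)` agreeing with `y` on the first
`m` blocks and vanishing elsewhere. -/
def pad {N n : ℕ} (y : Fin N → Fin n → ℝ) (m : ℕ) : Fin N → Fin n → ℝ :=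
  fun k => if (k : ℕ) < m then y k else 0

/-- `hP f y z = Σ_{i=1}^N [f_i(z_1+y_1,…,z_i+y_i,z_{i+1},…,z_N)
                            - f_i(z_1+y_1,…,z_{i-1}+y_{i-1},z_i,…,z_N)]`. -/
def hP {N n : ℕ} (f : Fin N → (Fin N → Fin n → ℝ) → ℝ)
    (y z : Fin N → Fin n → ℝ) : ℝ :=
  ∑ i : Fin N, (f i (z + pad y ((i : ℕ) + 1)) - f i (z + pad y (i : ℕ)))

/-- For distinct players `i, j` and a profile `w` of the remaining players' actions,
`hij f i j y_j y_i z_j z_i w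
  = f_i⟨z_i+y_i, z_j⟩ - f_i⟨z_i, z_j⟩ + f_j⟨z_i+y_i, z_j+y_j⟩ - f_j⟨z_i+y_i, z_j⟩`,
where `⟨a, b⟩` is the joint action in which player `i` plays `a`, player `j` plays `b`, and
every other player `k` plays `w k`. -/
def hij {N n : ℕ} (f : Fin N → (Fin N → Fin n → ℝ) → ℝ) (i j : Fin N)
    (yj yi zj zi : Fin n → ℝ) (w : Fin N → Fin n → ℝ) : ℝ :=
  f i (Function.update (Function.update w i (zi + yi)) j zj)
    - f i (Function.update (Function.update w i zi) j zj)
    + f j (Function.update (Function.update w i (zi + yi)) j (zj + yj))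
    - f j (Function.update (Function.update w i (zi + yi)) j zj)

/-- In an `N`-player aggregative game (`N ≥ 2`), if `h_P(z, 0) = 0` for
every `z`, then player `N`'s payoff is independent of its own action:
`f_N(x_N, x_{-N}) = f_N(0, x_{-N})` for every joint action `x` (the game is abnormal). -/
theorem aggregative_hP_zero_abnormal {N n : ℕ} (hN : 2 ≤ N)
    (f : Fin N → (Fin N → Fin n → ℝ) → ℝ)
    (hagg : ∃ (m : ℕ) (g : (Fin n → ℝ) → (Fin m → ℝ))
        (ft : Fin N → (Fin n → ℝ) → (Fin m → ℝ) → ℝ),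
        ∀ (i : Fin N) (x : Fin N → Fin n → ℝ), f i x = ft i (x i) (g (∑ k, x k)))
    (hzero : ∀ z : Fin N → Fin n → ℝ, hP f z 0 = 0) :
    ∀ x : Fin N → Fin n → ℝ,
      f ⟨N - 1, by omega⟩ x = f ⟨N - 1, by omega⟩ (Function.update x ⟨N - 1, by omega⟩ 0) := by
  intro x
  set l : Fin N := ⟨N - 1, by omega⟩ with hl
  have hlv : (l : ℕ) = N - 1 := rfl
  have key : ∀ m : ℕ, m ≤ N - 1 → pad (Function.update x l 0) m = pad x m := by
    intro m hm
    funext k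
    unfold pad
    by_cases hk : (k : ℕ) < m
    · have hne : k ≠ l := by
        intro h
        rw [h] at hk
        omega
      simp [hk, hne]
    · simp [hk]
  have full : ∀ y : Fin N → Fin n → ℝ, pad y (N - 1 + 1) = y := by
    intro y
    funext k
    have hk : (k : ℕ) < N - 1 + 1 := by omega
    simp [pad, hk]
  have cut : pad x (N - 1) = Function.update x l 0 := by
    funext k
    by_cases h : k = l
    · subst h
      simp [pad, hlv]
    · have hne : (k : ℕ) ≠ N - 1 := fun h' => h (Fin.ext h')
      have hk : (k : ℕ) < N - 1 := by omega
      simp [pad, hk, h]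
  have h1 := hzero x
  have h2 := hzero (Function.update x l 0)
  unfold hP at h1 h2
  rw [← Finset.add_sum_erase _ _ (Finset.mem_univ l)] at h1 h2
  have h3 : ∀ i ∈ Finset.univ.erase l,
      (f i (0 + pad (Function.update x l 0) ((i : ℕ) + 1))
        - f i (0 + pad (Function.update x l 0) (i : ℕ)))
      = f i (0 + pad x ((i : ℕ) + 1)) - f i (0 + pad x (i : ℕ)) := by
    intro i hi
    have h : i ≠ l := Finset.ne_of_mem_erase hi
    have hne : (i : ℕ) ≠ N - 1 := fun h' => h (Fin.ext h')
    rw [key _ (by omega), key _ (by omega)]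
  rw [Finset.sum_congr rfl h3] at h2
  simp only [hlv, full, key _ le_rfl, cut, zero_add] at h1 h2
  linarith
end
end

section
/- An N-player game with payoffs f_i : (ℝ^n)^N → ℝ is a potential game if and only if there exists a function W : (ℝ^n)^N → ℝ such that for all y, z ∈ (ℝ^n)^N, W(z+y) − W(z) = Σ_{i=1}^N [f_i(z_1+y_1,…,z_i+y_i,z_{i+1},…,z_N) − f_i(z_1+y_1,…,z_{i−1}+y_{i−1},z_i,…,z_N)]. Moreover, any such W is a potential function of the game. -/
noncomputable section

/-- The game with payoffs `f` is a potential game iff there is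
`W : (ℝ^n)^N → ℝ` with `W(z+y) - W(z) = h_P(y, z)` for all `y, z`; moreover any such `W`
is a potential function of the game. -/
theorem potential_iff_exists_W {N n : ℕ} (f : Fin N → (Fin N → Fin n → ℝ) → ℝ) :
    ((∃ φ : (Fin N → Fin n → ℝ) → ℝ, PotentialFn f φ) ↔
      (∃ W : (Fin N → Fin n → ℝ) → ℝ, ∀ y z : Fin N → Fin n → ℝ,
        W (z + y) - W z = hP f y z)) ∧
    (∀ W : (Fin N → Fin n → ℝ) → ℝ,
      (∀ y z : Fin N → Fin n → ℝ, W (z + y) - W z = hP f y z) → PotentialFn f W) := by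
  have key : ∀ W : (Fin N → Fin n → ℝ) → ℝ,
      (∀ y z : Fin N → Fin n → ℝ, W (z + y) - W z = hP f y z) → PotentialFn f W := by
    intro W hW i x x'
    have hy : x + Pi.single i (x' - x i) = Function.update x i x' := by
      funext k
      by_cases hk : k = i
      · subst hk; simp
      · simp [hk]
    have hpad : ∀ m : ℕ, pad (Pi.single i (x' - x i) : Fin N → Fin n → ℝ) m
        = if (i : ℕ) < m then Pi.single i (x' - x i) else 0 := by
      intro m
      funext k
      by_cases hk : k = i
      · subst hk
        by_cases hm : (k : ℕ) < m <;> simp [pad, hm]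
      · by_cases hm : (i : ℕ) < m <;> simp [pad, hm, hk]
    have h := hW (Pi.single i (x' - x i)) x
    unfold hP at h
    rw [Finset.sum_eq_single i] at h
    · rw [hpad, hpad, if_pos (Nat.lt_succ_self _), if_neg (lt_irrefl _), hy, add_zero] at h
      exact h.symm
    · intro j _ hj
      have hji : (j : ℕ) ≠ (i : ℕ) := fun e => hj (Fin.ext e)
      rw [hpad, hpad]
      by_cases hlt : (i : ℕ) < (j : ℕ)
      · rw [if_pos hlt, if_pos (Nat.lt_succ_of_lt hlt), sub_self]
      · rw [if_neg hlt, if_neg (by omega), sub_self]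
    · intro hi
      exact absurd (Finset.mem_univ i) hi
  refine ⟨⟨?_, fun ⟨W, hW⟩ => ⟨W, key W hW⟩⟩, key⟩
  rintro ⟨φ, hφ⟩
  refine ⟨φ, fun y z => ?_⟩
  have step : ∀ i : Fin N, f i (z + pad y ((i : ℕ) + 1)) - f i (z + pad y (i : ℕ))
      = φ (z + pad y ((i : ℕ) + 1)) - φ (z + pad y (i : ℕ)) := by
    intro i
    have e : z + pad y ((i : ℕ) + 1) = Function.update (z + pad y (i : ℕ)) i (z i + y i) := by
      funext k
      by_cases hk : k = i
      · subst hk; simp [pad]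
      · have hki : (k : ℕ) ≠ (i : ℕ) := fun e => hk (Fin.ext e)
        have : (k : ℕ) < (i : ℕ) + 1 ↔ (k : ℕ) < (i : ℕ) := by omega
        simp [pad, hk, this]
    rw [e]
    exact hφ i _ _
  unfold hP
  rw [Finset.sum_congr rfl (fun i _ => step i),
    Fin.sum_univ_eq_sum_range (fun m => φ (z + pad y (m + 1)) - φ (z + pad y m)) N,
    Finset.sum_range_sub (fun m => φ (z + pad y m))]
  have h0 : pad y 0 = 0 := by funext k; simp [pad]
  have hN : pad y N = y := by funext k; simp [pad]
  rw [h0, hN, add_zero]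
end
end

section
/- If an N-player game with payoffs f_i : (ℝ^n)^N → ℝ is a potential game with potential function φ, then for all y, z ∈ (ℝ^n)^N, h_P(y, z) = h_P(−z, z) − h_P(−(z+y), z+y). -/
noncomputable section

/-- For a potential game, `h_P(y, z)` telescopes to `φ(z + y) - φ(z)`. -/
theorem hP_eq_potential_sub {N n : ℕ} (f : Fin N → (Fin N → Fin n → ℝ) → ℝ)
    (φ : (Fin N → Fin n → ℝ) → ℝ) (hpot : PotentialFn f φ)
    (y z : Fin N → Fin n → ℝ) : hP f y z = φ (z + y) - φ z := by
  have step : ∀ i : Fin N, f i (z + pad y ((i : ℕ) + 1)) - f i (z + pad y (i : ℕ))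
      = φ (z + pad y ((i : ℕ) + 1)) - φ (z + pad y (i : ℕ)) := by
    intro i
    have hu : z + pad y ((i : ℕ) + 1)
        = Function.update (z + pad y (i : ℕ)) i (z i + y i) := by
      funext k
      by_cases hk : k = i
      · subst hk
        simp [pad]
      · have hne : (k : ℕ) ≠ (i : ℕ) := fun h => hk (Fin.ext h)
        have hiff : (k : ℕ) < (i : ℕ) + 1 ↔ (k : ℕ) < (i : ℕ) := by omega
        simp only [Function.update_of_ne hk, Pi.add_apply, pad, hiff]
    rw [hu]
    exact hpot i _ _
  have h0 : pad y 0 = 0 := by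
    funext k
    simp [pad]
  have hN : pad y N = y := by
    funext k
    simp [pad]
  unfold hP
  rw [Finset.sum_congr rfl (fun i _ => step i),
    Fin.sum_univ_eq_sum_range (fun m => φ (z + pad y (m + 1)) - φ (z + pad y m)) N,
    Finset.sum_range_sub (fun m => φ (z + pad y m)) N, h0, hN, add_zero]

/-- If the game with payoffs `f` is a potential game with potential
function `φ`, then for all `y, z`, `h_P(y, z) = h_P(-z, z) - h_P(-(z+y), z+y)`. -/
theorem hP_eq_of_potential {N n : ℕ} (f : Fin N → (Fin N → Fin n → ℝ) → ℝ)
    (φ : (Fin N → Fin n → ℝ) → ℝ) (hpot : PotentialFn f φ) :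
    ∀ y z : Fin N → Fin n → ℝ,
      hP f y z = hP f (-z) z - hP f (-(z + y)) (z + y) := by
  intro y z
  simp only [hP_eq_potential_sub f φ hpot, add_neg_cancel]
  ring
end
end

section
/- An N-player game with payoffs f_i : (ℝ^n)^N → ℝ is a potential game if and only if h_P(y, z) = h_P(y+z, 0) − h_P(z, 0) for all y, z ∈ (ℝ^n)^N; and in that case, for any constant C ∈ ℝ, the function z ↦ C − h_P(−z, z) is a potential function of the game. -/
noncomputable section

theorem hP_of_potential {N n : ℕ} (f : Fin N → (Fin N → Fin n → ℝ) → ℝ)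
    (φ : (Fin N → Fin n → ℝ) → ℝ) (h : PotentialFn f φ) (y z : Fin N → Fin n → ℝ) :
    hP f y z = φ (z + y) - φ z := by
  have key : ∀ i : Fin N, f i (z + pad y ((i : ℕ) + 1)) - f i (z + pad y (i : ℕ))
      = φ (z + pad y ((i : ℕ) + 1)) - φ (z + pad y (i : ℕ)) := by
    intro i
    have e : z + pad y ((i : ℕ) + 1) = Function.update (z + pad y (i : ℕ)) i (z i + y i) := by
      funext k
      by_cases hk : k = i
      · subst hk
        simp [pad]
      · have hk' : (k : ℕ) ≠ i := fun h => hk (Fin.ext h)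
        have : ((k : ℕ) < (i : ℕ) + 1) ↔ ((k : ℕ) < (i : ℕ)) := by omega
        simp [pad, hk, this]
    rw [e]
    exact h _ _ _
  unfold hP
  rw [Finset.sum_congr rfl (fun i _ => key i),
    Fin.sum_univ_eq_sum_range (fun m => φ (z + pad y (m + 1)) - φ (z + pad y m)) N,
    Finset.sum_range_sub (fun m => φ (z + pad y m))]
  have e1 : pad y N = y := by
    funext k
    simp [pad]
  have e0 : pad y 0 = 0 := by
    funext k
    simp [pad]
  rw [e1, e0, add_zero]

theorem hP_single {N n : ℕ} (f : Fin N → (Fin N → Fin n → ℝ) → ℝ) (i : Fin N)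
    (x : Fin N → Fin n → ℝ) (x' : Fin n → ℝ) :
    hP f (Function.update x i x' - x) x = f i (Function.update x i x') - f i x := by
  unfold hP
  rw [Finset.sum_eq_single i]
  · congr 2
    · funext k
      by_cases hk : k = i
      · subst hk
        simp [pad]
      · simp [pad, hk]
    · funext k
      by_cases hk : k = i
      · subst hk
        simp [pad]
      · simp [pad, hk]
  · intro j _ hj
    have e : pad (Function.update x i x' - x) ((j : ℕ) + 1)
        = pad (Function.update x i x' - x) (j : ℕ) := by
      funext k
      by_cases hk : k = i
      · subst hk
        have hk' : (k : ℕ) ≠ j := fun h => hj (Fin.ext h.symm)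
        have : ((k : ℕ) < (j : ℕ) + 1) ↔ ((k : ℕ) < (j : ℕ)) := by omega
        simp [pad, this]
      · simp [pad, hk]
    rw [e, sub_self]
  · simp

theorem potential_of_cocycle {N n : ℕ} (f : Fin N → (Fin N → Fin n → ℝ) → ℝ)
    (h : ∀ y z : Fin N → Fin n → ℝ, hP f y z = hP f (y + z) 0 - hP f z 0) (C : ℝ) :
    PotentialFn f (fun z => C - hP f (-z) z) := by
  intro i x x'
  have h1 := h (Function.update x i x' - x) x
  rw [hP_single, sub_add_cancel] at h1
  have h2 := h (-x) x
  have h3 := h (-(Function.update x i x')) (Function.update x i x')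
  rw [neg_add_cancel] at h2 h3
  simp only
  linarith

/-- The game with payoffs `f` is a potential game iff
`h_P(y, z) = h_P(y+z, 0) - h_P(z, 0)` for all `y, z`; and in that case, for any constant
`C ∈ ℝ`, the function `z ↦ C - h_P(-z, z)` is a potential function of the game. -/
theorem potential_iff_hP_cocycle {N n : ℕ} (f : Fin N → (Fin N → Fin n → ℝ) → ℝ) :
    ((∃ φ : (Fin N → Fin n → ℝ) → ℝ, PotentialFn f φ) ↔
      (∀ y z : Fin N → Fin n → ℝ, hP f y z = hP f (y + z) 0 - hP f z 0)) ∧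
    ((∀ y z : Fin N → Fin n → ℝ, hP f y z = hP f (y + z) 0 - hP f z 0) →
      ∀ C : ℝ, PotentialFn f (fun z => C - hP f (-z) z)) := by
  refine ⟨⟨?_, fun h => ⟨_, potential_of_cocycle f h 0⟩⟩, potential_of_cocycle f⟩
  rintro ⟨φ, h⟩ y z
  rw [hP_of_potential f φ h, hP_of_potential f φ h, hP_of_potential f φ h,
    zero_add, zero_add, add_comm z y]
  ring
end
end

section
/- Let f_1,…,f_N : (ℝ^n)^N → ℝ be the payoffs of an N-player game, let i* ≠ j* be two players, and let π be a permutation of {1,…,N} with π(N−1) = i* and π(N) = j*. For w, z ∈ (ℝ^n)^N define h_π(w, z) = Σ_{e=1}^N [f_{π(e)}(z + Σ_{l=1}^{e} w^{π(l)}) − f_{π(e)}(z + Σ_{l=1}^{e−1} w^{π(l)})], where w^{k} denotes the joint action that equals w on block k and is 0 on all other blocks. If y ∈ (ℝ^n)^N satisfies y_k = 0 for all k ∉ {i*, j*}, then for every z ∈ (ℝ^n)^N, h_π(y+z, 0) − h_π(z, 0) = h_{i*j*}(y_{j*}+z_{j*}, y_{i*}+z_{i*}, 0, 0; z_{-{i*,j*}})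 − h_{i*j*}(z_{j*}, z_{i*}, 0, 0; z_{-{i*,j*}}). -/
noncomputable section

/-- `hPerm f π w z = Σ_{e=1}^N [f_{π(e)}(z + Σ_{l=1}^e w^{π(l)}) - f_{π(e)}(z + Σ_{l=1}^{e-1} w^{π(l)})]`,
where `w^k` is the joint action equal to `w` on block `k` and `0` elsewhere. -/
def hPerm {N n : ℕ} (f : Fin N → (Fin N → Fin n → ℝ) → ℝ) (π : Equiv.Perm (Fin N))
    (w z : Fin N → Fin n → ℝ) : ℝ :=
  ∑ e : Fin N,
    (f (π e) (z + ∑ l ∈ Finset.Iic e, Pi.single (π l) (w (π l)))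
      - f (π e) (z + ∑ l ∈ Finset.Iio e, Pi.single (π l) (w (π l))))

theorem partial_sum_eq {N n : ℕ} (π : Equiv.Perm (Fin N)) (w : Fin N → Fin n → ℝ)
    (S : Finset (Fin N)) :
    ∑ l ∈ S, (Pi.single (π l) (w (π l)) : Fin N → Fin n → ℝ)
      = fun k => if π.symm k ∈ S then w k else 0 := by
  classical
  funext k
  rw [Finset.sum_apply]
  have h : ∀ l ∈ S, (Pi.single (π l) (w (π l)) : Fin N → Fin n → ℝ) k
      = if π.symm k = l then w k else 0 := by
    intro l _
    by_cases hl : π.symm k = l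
    · subst hl
      simp
    · rw [if_neg hl, Pi.single_eq_of_ne]
      intro hk
      exact hl (by simp [hk])
  rw [Finset.sum_congr rfl h, Finset.sum_ite_eq]

/-- Let `π` be a permutation of the players with `π(N-1) = i*`, `π(N) = j*`,
`i* ≠ j*`.  If `y` vanishes on all blocks other than `i*, j*`, then for every `z`,
`h_π(y+z, 0) - h_π(z, 0)
  = h_{i*j*}(y_{j*}+z_{j*}, y_{i*}+z_{i*}, 0, 0; z_{-{i*,j*}})
      - h_{i*j*}(z_{j*}, z_{i*}, 0, 0; z_{-{i*,j*}})`. -/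
theorem hPerm_diff_eq_hij {N n : ℕ} (hN : 2 ≤ N)
    (f : Fin N → (Fin N → Fin n → ℝ) → ℝ)
    (istar jstar : Fin N) (hne : istar ≠ jstar)
    (π : Equiv.Perm (Fin N))
    (hπ1 : π ⟨N - 2, by omega⟩ = istar) (hπ2 : π ⟨N - 1, by omega⟩ = jstar)
    (y : Fin N → Fin n → ℝ) (hy : ∀ k : Fin N, k ≠ istar → k ≠ jstar → y k = 0) :
    ∀ z : Fin N → Fin n → ℝ,
      hPerm f π (y + z) 0 - hPerm f π z 0 =
        hij f istar jstar (y jstar + z jstar) (y istar + z istar) 0 0 z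
          - hij f istar jstar (z jstar) (z istar) 0 0 z := by
  intro z
  set e1 : Fin N := ⟨N - 2, by omega⟩ with he1
  set e2 : Fin N := ⟨N - 1, by omega⟩ with he2
  have h12 : e1 ≠ e2 := by
    intro h
    simp only [he1, he2, Fin.mk.injEq] at h
    omega
  have hs1 : π.symm istar = e1 := by rw [← hπ1]; simp
  have hs2 : π.symm jstar = e2 := by rw [← hπ2]; simp
  have hlt : ∀ e : Fin N, e ≠ e1 → e ≠ e2 → e < e1 ∧ e < e2 := by
    intro e h1 h2
    have := e.isLt
    simp only [he1, he2, Fin.lt_def, ne_eq, Fin.ext_iff] at *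
    omega
  have h12' : e1 < e2 := by
    simp only [he1, he2, Fin.lt_def]
    omega
  have hk : ∀ k, k ≠ istar → k ≠ jstar → π.symm k < e1 ∧ π.symm k < e2 := by
    intro k h1 h2
    apply hlt
    · intro h; apply h1; rw [← hπ1, ← h]; simp
    · intro h; apply h2; rw [← hπ2, ← h]; simp
  -- the last two partial sums, for a profile agreeing with `z` off the two players
  have key : ∀ w : Fin N → Fin n → ℝ, (∀ k, k ≠ istar → k ≠ jstar → w k = z k) →
      ((fun k => if π.symm k ∈ Finset.Iio e1 then w k else 0)
        = Function.update (Function.update z istar 0) jstar 0) ∧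
      ((fun k => if π.symm k ∈ Finset.Iic e1 then w k else 0)
        = Function.update (Function.update z istar (0 + w istar)) jstar 0) ∧
      ((fun k => if π.symm k ∈ Finset.Iio e2 then w k else 0)
        = Function.update (Function.update z istar (0 + w istar)) jstar 0) ∧
      ((fun k => if π.symm k ∈ Finset.Iic e2 then w k else 0)
        = Function.update (Function.update z istar (0 + w istar)) jstar (0 + w jstar)) := by
    intro w hw
    refine ⟨?_, ?_, ?_, ?_⟩ <;>
    · funext k
      by_cases hj : k = jstar
      · subst hj
        simp [hs2, h12', h12'.le]
      · by_cases hi : k = istar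
        · subst hi
          simp [hs1, hj, h12', h12'.le]
        · have := hk k hi hj
          simp [hi, hj, this.1, this.2, this.1.le, this.2.le, hw k hi hj]
  have key1 := key (y + z) (fun k h1 h2 => by simp [hy k h1 h2])
  have key2 := key z (fun k _ _ => rfl)
  unfold hPerm
  simp only [partial_sum_eq, zero_add]
  rw [← Finset.sum_sub_distrib, Finset.sum_eq_add e1 e2 h12]
  · rw [key1.1, key1.2.1, key1.2.2.1, key1.2.2.2, key2.1, key2.2.1, key2.2.2.1, key2.2.2.2,
      hπ1, hπ2]
    simp only [hij, Pi.add_apply]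
    ring
  · rintro e - ⟨h1, h2⟩
    have hl := hlt e h1 h2
    have hoff : ∀ k, π.symm k ≤ e → (y + z) k = z k := by
      intro k hke
      have hi : k ≠ istar := by
        rintro rfl
        rw [hs1] at hke
        exact absurd hl.1 (not_lt.mpr hke)
      have hj : k ≠ jstar := by
        rintro rfl
        rw [hs2] at hke
        exact absurd hl.2 (not_lt.mpr hke)
      simp [hy k hi hj]
    have ha : (fun k => if π.symm k ∈ Finset.Iic e then (y + z) k else 0)
        = fun k => if π.symm k ∈ Finset.Iic e then z k else 0 := by
      funext k
      split_ifs with h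
      · exact hoff k (Finset.mem_Iic.mp h)
      · rfl
    have hb : (fun k => if π.symm k ∈ Finset.Iio e then (y + z) k else 0)
        = fun k => if π.symm k ∈ Finset.Iio e then z k else 0 := by
      funext k
      split_ifs with h
      · exact hoff k (Finset.mem_Iio.mp h).le
      · rfl
    rw [ha, hb, sub_self]
  · intro h; exact absurd (Finset.mem_univ _) h
  · intro h; exact absurd (Finset.mem_univ _) h
end
end

section
/- An N-player game with payoffs f_i : (ℝ^n)^N → ℝ is a potential game if and only if for all distinct players i, j, all y_i, z_i, y_j, z_j ∈ ℝ^n, and every profile z_{-{i,j}} of the remaining players' actions, h_{ij}(y_j, y_i, z_j, z_i; z_{-{i,j}}) = h_{ij}(y_j+z_j, y_i+z_i, 0, 0; z_{-{i,j}}) − h_{ij}(z_j, z_i, 0, 0; z_{-{i,j}}). -/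
noncomputable section

theorem four_cycle {N n : ℕ} (f : Fin N → (Fin N → Fin n → ℝ) → ℝ)
    (H : ∀ (i j : Fin N), i ≠ j →
        ∀ (yi zi yj zj : Fin n → ℝ) (w : Fin N → Fin n → ℝ),
          hij f i j yj yi zj zi w =
            hij f i j (yj + zj) (yi + zi) 0 0 w - hij f i j zj zi 0 0 w)
    (i j : Fin N) (hne : i ≠ j) (a a' b b' : Fin n → ℝ) (w : Fin N → Fin n → ℝ) :
    f i (Function.update (Function.update w i a') j b)
      - f i (Function.update (Function.update w i a) j b)
      + f j (Function.update (Function.update w i a') j b')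
      - f j (Function.update (Function.update w i a') j b)
    = f j (Function.update (Function.update w i a) j b')
      - f j (Function.update (Function.update w i a) j b)
      + f i (Function.update (Function.update w i a') j b')
      - f i (Function.update (Function.update w i a) j b') := by
  have h1 := H i j hne (a' - a) a (b' - b) b w
  have h2 := H i j hne (a' - a) a 0 b' w
  have h3 := H i j hne 0 a (b' - b) b w
  simp only [hij, add_sub_cancel, sub_add_cancel, zero_add, add_zero] at h1 h2 h3
  linarith

def partSum {N n : ℕ} (f : Fin N → (Fin N → Fin n → ℝ) → ℝ) (x : Fin N → Fin n → ℝ) :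
    ℕ → ℝ
  | 0 => 0
  | m + 1 => partSum f x m +
      if h : m < N then f ⟨m, h⟩ (pad x (m + 1)) - f ⟨m, h⟩ (pad x m) else 0

theorem pad_eq {N n : ℕ} (x : Fin N → Fin n → ℝ) (k : Fin N) (a : Fin n → ℝ) (m : ℕ)
    (hm : m ≤ k) : pad (Function.update x k a) m = pad x m := by
  funext t
  unfold pad
  split_ifs with h
  · rw [Function.update_of_ne]
    rintro rfl
    omega
  · rfl

theorem partSum_diff {N n : ℕ} (f : Fin N → (Fin N → Fin n → ℝ) → ℝ)
    (H : ∀ (i j : Fin N), i ≠ j →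
        ∀ (yi zi yj zj : Fin n → ℝ) (w : Fin N → Fin n → ℝ),
          hij f i j yj yi zj zi w =
            hij f i j (yj + zj) (yi + zi) 0 0 w - hij f i j zj zi 0 0 w)
    (k : Fin N) (x : Fin N → Fin n → ℝ) (a : Fin n → ℝ) (m : ℕ) (hm : m ≤ N) :
    partSum f (Function.update x k a) m - partSum f x m
      = f k (pad (Function.update x k a) m) - f k (pad x m) := by
  induction m with
  | zero => rw [pad_eq x k a 0 (Nat.zero_le _)]; simp [partSum]
  | succ m ih =>
    have hmN : m < N := hm
    have ih := ih hmN.le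
    simp only [partSum, hmN, dite_true]
    by_cases hk : k = ⟨m, hmN⟩
    · subst hk
      rw [pad_eq x ⟨m, hmN⟩ a m le_rfl] at ih ⊢
      linarith
    · have hk' : (k : ℕ) ≠ m := fun h => hk (Fin.ext h)
      have key := four_cycle f H k ⟨m, hmN⟩ hk (pad x m k) (pad (Function.update x k a) m k)
        0 (x ⟨m, hmN⟩) (pad x m)
      have e : ∀ A c, (A = pad x m k ∧ c = x ∨
          A = pad (Function.update x k a) m k ∧ c = Function.update x k a) →
          Function.update (Function.update (pad x m) k A) ⟨m, hmN⟩ 0 = pad c m ∧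
          Function.update (Function.update (pad x m) k A) ⟨m, hmN⟩ (x ⟨m, hmN⟩)
            = pad c (m + 1) := by
        intro A c hA
        constructor <;>
        · funext t
          by_cases ht : t = ⟨m, hmN⟩
          · subst ht
            rcases hA with ⟨rfl, rfl⟩ | ⟨rfl, rfl⟩ <;> simp [pad, Function.update_of_ne (Ne.symm hk)]
          · have ht' : (t : ℕ) ≠ m := fun h => ht (Fin.ext h)
            have h3 : (t : ℕ) < m + 1 ↔ (t : ℕ) < m := by omega
            rw [Function.update_of_ne ht]
            by_cases htk : t = k
            · subst htk
              rcases hA with ⟨rfl, rfl⟩ | ⟨rfl, rfl⟩ <;> simp [pad, h3]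
            · rcases hA with ⟨rfl, rfl⟩ | ⟨rfl, rfl⟩ <;> simp [pad, h3, htk]
      obtain ⟨e1, e2⟩ := e _ _ (Or.inl ⟨rfl, rfl⟩)
      obtain ⟨e3, e4⟩ := e _ _ (Or.inr ⟨rfl, rfl⟩)
      rw [e1, e2, e3, e4] at key
      linarith

/-- The game with payoffs `f` is a potential game iff for all distinct
players `i, j`, all actions `y_i, z_i, y_j, z_j` and every profile `w` of the remaining
players' actions,
`h_{ij}(y_j, y_i, z_j, z_i; w) = h_{ij}(y_j+z_j, y_i+z_i, 0, 0; w) - h_{ij}(z_j, z_i, 0, 0; w)`. -/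
theorem potential_iff_hij_cocycle {N n : ℕ} (f : Fin N → (Fin N → Fin n → ℝ) → ℝ) :
    (∃ φ : (Fin N → Fin n → ℝ) → ℝ, PotentialFn f φ) ↔
      (∀ (i j : Fin N), i ≠ j →
        ∀ (yi zi yj zj : Fin n → ℝ) (w : Fin N → Fin n → ℝ),
          hij f i j yj yi zj zi w =
            hij f i j (yj + zj) (yi + zi) 0 0 w - hij f i j zj zi 0 0 w) := by
  constructor
  · rintro ⟨φ, hφ⟩ i j hne
    have key : ∀ (yi zi yj zj : Fin n → ℝ) (w : Fin N → Fin n → ℝ),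
        hij f i j yj yi zj zi w =
          φ (Function.update (Function.update w i (zi + yi)) j (zj + yj))
          - φ (Function.update (Function.update w i zi) j zj) := by
      intro yi zi yj zj w
      have h1 := hφ i (Function.update (Function.update w i zi) j zj) (zi + yi)
      have h2 := hφ j (Function.update (Function.update w i (zi + yi)) j zj) (zj + yj)
      rw [Function.update_comm hne.symm, Function.update_idem] at h1
      rw [Function.update_idem] at h2
      unfold hij
      linarith
    intro yi zi yj zj w
    simp only [key, zero_add, add_comm yi zi, add_comm yj zj]
    ring
  · intro H
    refine ⟨fun x => partSum f x N, ?_⟩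
    intro k x a
    have h := partSum_diff f H k x a N le_rfl
    have hp : ∀ y : Fin N → Fin n → ℝ, pad y N = y := by
      intro y; funext t; simp [pad]
    rw [hp, hp] at h
    exact h.symm
end
end

section
/- Let an N-player game with N ≥ 2 and payoffs f_i : (ℝ^n)^N → ℝ be a potential game with potential function φ. Then for every z ∈ (ℝ^n)^N, φ(z) = φ(0) + h_P((z_1,…,z_{N−2},0,0), 0) + h_{N−1,N}(z_N, z_{N−1}, 0, 0; (z_1,…,z_{N−2})), where (z_1,…,z_{N−2}) is the profile of actions of players 1,…,N−2. -/
noncomputable section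

theorem pot_hP {N n : ℕ} (f : Fin N → (Fin N → Fin n → ℝ) → ℝ)
    (φ : (Fin N → Fin n → ℝ) → ℝ) (hpot : PotentialFn f φ) (y : Fin N → Fin n → ℝ) :
    hP f y 0 = φ y - φ 0 := by
  have h1 : ∀ i : Fin N, f i (0 + pad y ((i : ℕ) + 1)) - f i (0 + pad y (i : ℕ))
      = φ (pad y ((i : ℕ) + 1)) - φ (pad y (i : ℕ)) := by
    intro i
    have h := hpot i (pad y (i : ℕ)) (y i)
    have e : Function.update (pad y (i : ℕ)) i (y i) = pad y ((i : ℕ) + 1) := by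
      funext k
      by_cases hk : k = i
      · subst hk
        simp [pad]
      · have hk' : (k : ℕ) ≠ i := fun h => hk (Fin.ext h)
        have : (k : ℕ) < i ↔ (k : ℕ) < i + 1 := by omega
        simp only [Function.update_of_ne hk, pad, this]
    rw [e] at h
    simpa only [zero_add] using h
  unfold hP
  rw [Finset.sum_congr rfl (fun i _ => h1 i),
    Fin.sum_univ_eq_sum_range (fun i => φ (pad y (i + 1)) - φ (pad y i)) N,
    Finset.sum_range_sub (fun i => φ (pad y i))]
  have e0 : pad y 0 = 0 := by funext k; simp [pad]
  have eN : pad y N = y := by funext k; simp [pad]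
  rw [e0, eN]

/-- If the `N`-player game (`N ≥ 2`) with payoffs `f` is a potential game
with potential function `φ`, then for every `z`,
`φ(z) = φ(0) + h_P((z_1,…,z_{N-2},0,0), 0) + h_{N-1,N}(z_N, z_{N-1}, 0, 0; (z_1,…,z_{N-2}))`. -/
theorem potential_decomposition_lastTwo {N n : ℕ} (hN : 2 ≤ N)
    (f : Fin N → (Fin N → Fin n → ℝ) → ℝ)
    (φ : (Fin N → Fin n → ℝ) → ℝ) (hpot : PotentialFn f φ) :
    ∀ z : Fin N → Fin n → ℝ,
      φ z = φ 0 + hP f (pad z (N - 2)) 0 +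
        hij f ⟨N - 2, by omega⟩ ⟨N - 1, by omega⟩
          (z ⟨N - 1, by omega⟩) (z ⟨N - 2, by omega⟩) 0 0 (pad z (N - 2)) := by
  intro z
  rw [pot_hP f φ hpot]
  unfold hij
  have hne : (⟨N - 2, by omega⟩ : Fin N) ≠ ⟨N - 1, by omega⟩ := by
    intro h
    have := congrArg Fin.val h
    simp only at this
    omega
  have hz : Function.update (Function.update (pad z (N - 2)) ⟨N - 2, by omega⟩
      (z ⟨N - 2, by omega⟩)) ⟨N - 1, by omega⟩ (z ⟨N - 1, by omega⟩) = z := by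
    funext k
    by_cases hk : k = ⟨N - 1, by omega⟩
    · subst hk
      simp
    · rw [Function.update_of_ne hk]
      by_cases hk2 : k = ⟨N - 2, by omega⟩
      · subst hk2
        simp
      · rw [Function.update_of_ne hk2]
        have a1 : (k : ℕ) ≠ N - 1 := fun h => hk (Fin.ext h)
        have a2 : (k : ℕ) ≠ N - 2 := fun h => hk2 (Fin.ext h)
        have a3 : (k : ℕ) < N - 2 := by have := k.2; omega
        simp [pad, a3]
  have h0 : Function.update (Function.update (pad z (N - 2)) ⟨N - 2, by omega⟩ 0)
      ⟨N - 1, by omega⟩ 0 = pad z (N - 2) := by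
    have b1 : pad z (N - 2) ⟨N - 2, by omega⟩ = 0 := by simp [pad]
    have b2 : pad z (N - 2) ⟨N - 1, by omega⟩ = 0 := by
      simp only [pad]
      rw [if_neg (by omega)]
    rw [Function.update_eq_self_iff.2 (by rw [Function.update_of_ne hne.symm, b2]),
      Function.update_eq_self_iff.2 b1.symm]
  have p1 := hpot ⟨N - 2, by omega⟩ (pad z (N - 2)) (z ⟨N - 2, by omega⟩)
  have p2 := hpot ⟨N - 1, by omega⟩ (Function.update (pad z (N - 2)) ⟨N - 2, by omega⟩
      (z ⟨N - 2, by omega⟩)) (z ⟨N - 1, by omega⟩)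
  have h3 : Function.update (Function.update (pad z (N - 2)) ⟨N - 2, by omega⟩
      (z ⟨N - 2, by omega⟩)) ⟨N - 1, by omega⟩ 0 =
      Function.update (pad z (N - 2)) ⟨N - 2, by omega⟩ (z ⟨N - 2, by omega⟩) := by
    rw [Function.update_eq_self_iff, Function.update_of_ne hne.symm]
    simp only [pad]
    rw [if_neg (by omega)]
  simp only [zero_add]
  rw [h0, hz, h3]
  rw [hz] at p2
  linarith
end
end

section
/- Let N = 2K+1 for some K ∈ ℕ with K ≥ 1, and let an N-player game with payoffs f_i : (ℝ^n)^N → ℝ be a potential game with potential function φ. Then for every z ∈ (ℝ^n)^N, φ(z) = φ(0) + Σ_{i=1}^{3} [f_i(ẑ_i) − f_i(ẑ_{i−1})] + Σ_{i=2}^{K} h_{2i,2i+1}(z_{2i+1}, z_{2i}, 0, 0; ẑ_{2i−1}), where ẑ_m = (z_1,…,z_m,0,…,0) denotes the joint action agreeing with z in the first m blocks and zero elsewhere (in the last sum, ẑ_{2i−1} is used as the profile of the players other than 2i and 2i+1). -/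
noncomputable section

theorem pad_succ_aux {N n : ℕ} (z : Fin N → Fin n → ℝ) (a : Fin N) :
    Function.update (pad z (a : ℕ)) a (z a) = pad z ((a : ℕ) + 1) := by
  funext k
  by_cases h : k = a
  · subst h
    simp [pad]
  · have h' : (k : ℕ) ≠ (a : ℕ) := fun e => h (Fin.ext e)
    have h2 : ((k : ℕ) < (a : ℕ)) ↔ ((k : ℕ) < (a : ℕ) + 1) := by omega
    simp [Function.update_of_ne h, pad, h2]

theorem pad_zero_aux {N n : ℕ} (z : Fin N → Fin n → ℝ) (m : ℕ) (a : Fin N) (h : m ≤ (a : ℕ)) :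
    Function.update (pad z m) a 0 = pad z m := by
  rw [Function.update_eq_self_iff]
  simp [pad, Nat.not_lt.mpr h]

theorem step_aux {N n : ℕ} {f : Fin N → (Fin N → Fin n → ℝ) → ℝ}
    {φ : (Fin N → Fin n → ℝ) → ℝ} (hpot : PotentialFn f φ) (z : Fin N → Fin n → ℝ)
    (a : Fin N) :
    f a (pad z ((a : ℕ) + 1)) - f a (pad z (a : ℕ))
      = φ (pad z ((a : ℕ) + 1)) - φ (pad z (a : ℕ)) := by
  rw [← pad_succ_aux]
  exact hpot a _ _

theorem hij_aux {N n : ℕ} {f : Fin N → (Fin N → Fin n → ℝ) → ℝ}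
    {φ : (Fin N → Fin n → ℝ) → ℝ} (hpot : PotentialFn f φ) (z : Fin N → Fin n → ℝ)
    (a b : Fin N) (hab : (b : ℕ) = (a : ℕ) + 1) :
    hij f a b (z b) (z a) 0 0 (pad z (a : ℕ))
      = φ (pad z ((b : ℕ) + 1)) - φ (pad z (a : ℕ)) := by
  have h1 := step_aux hpot z a
  have h2 := step_aux hpot z b
  have e := pad_succ_aux z b
  unfold hij
  rw [zero_add, zero_add, pad_succ_aux, pad_zero_aux z _ a le_rfl,
    pad_zero_aux z _ b (by omega), pad_zero_aux z _ b (by omega), ← hab, e]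
  rw [← hab] at h1
  linarith

theorem tele_aux (g : ℕ → ℝ) (K : ℕ) (hK : 1 ≤ K) :
    ∑ i ∈ Finset.Icc 2 K, (g (2 * i + 1) - g (2 * i - 1)) = g (2 * K + 1) - g 3 := by
  induction K, hK using Nat.le_induction with
  | base => simp
  | succ k hk ih =>
    rw [Finset.sum_Icc_succ_top (by omega), ih]
    have : 2 * (k + 1) - 1 = 2 * k + 1 := by omega
    rw [this]
    ring

/-- Let `N = 2K+1`, `K ≥ 1`, and let the game with payoffs `f` be a
potential game with potential function `φ`.  Then for every `z`,
`φ(z) = φ(0) + Σ_{i=1}^{3} [f_i(ẑ_i) - f_i(ẑ_{i-1})]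
       + Σ_{i=2}^{K} h_{2i,2i+1}(z_{2i+1}, z_{2i}, 0, 0; ẑ_{2i-1})`,
where `ẑ_m = (z_1,…,z_m,0,…,0)` (here `pad z m`). -/
theorem potential_decomposition_odd {N n K : ℕ} (hK : 1 ≤ K) (hNK : N = 2 * K + 1)
    (f : Fin N → (Fin N → Fin n → ℝ) → ℝ)
    (φ : (Fin N → Fin n → ℝ) → ℝ) (hpot : PotentialFn f φ) :
    ∀ z : Fin N → Fin n → ℝ,
      φ z = φ 0 +
        (∑ e ∈ (Finset.range 3).attach,
          (f ⟨e.1, by have := Finset.mem_range.mp e.2; omega⟩ (pad z (e.1 + 1)) -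
            f ⟨e.1, by have := Finset.mem_range.mp e.2; omega⟩ (pad z e.1))) +
        ∑ i ∈ (Finset.Icc 2 K).attach,
          hij f ⟨2 * i.1 - 1, by have := Finset.mem_Icc.mp i.2; omega⟩
            ⟨2 * i.1, by have := Finset.mem_Icc.mp i.2; omega⟩
            (z ⟨2 * i.1, by have := Finset.mem_Icc.mp i.2; omega⟩)
            (z ⟨2 * i.1 - 1, by have := Finset.mem_Icc.mp i.2; omega⟩) 0 0
            (pad z (2 * i.1 - 1)) := by
  intro z
  have A : (∑ e ∈ (Finset.range 3).attach,
          (f ⟨e.1, by have := Finset.mem_range.mp e.2; omega⟩ (pad z (e.1 + 1)) -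
            f ⟨e.1, by have := Finset.mem_range.mp e.2; omega⟩ (pad z e.1)))
      = φ (pad z 3) - φ (pad z 0) := by
    rw [← Finset.sum_range_sub (fun m => φ (pad z m)) 3, ← Finset.sum_attach (Finset.range 3)]
    refine Finset.sum_congr rfl fun e _ => ?_
    exact step_aux hpot z ⟨e.1, by have := Finset.mem_range.mp e.2; omega⟩
  have B : (∑ i ∈ (Finset.Icc 2 K).attach,
          hij f ⟨2 * i.1 - 1, by have := Finset.mem_Icc.mp i.2; omega⟩
            ⟨2 * i.1, by have := Finset.mem_Icc.mp i.2; omega⟩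
            (z ⟨2 * i.1, by have := Finset.mem_Icc.mp i.2; omega⟩)
            (z ⟨2 * i.1 - 1, by have := Finset.mem_Icc.mp i.2; omega⟩) 0 0
            (pad z (2 * i.1 - 1))) = φ (pad z (2 * K + 1)) - φ (pad z 3) := by
    rw [← tele_aux (fun m => φ (pad z m)) K hK, ← Finset.sum_attach (Finset.Icc 2 K)]
    refine Finset.sum_congr rfl fun i _ => ?_
    have hi := Finset.mem_Icc.mp i.2
    exact hij_aux hpot z ⟨2 * i.1 - 1, by omega⟩ ⟨2 * i.1, by omega⟩
      (by simp only []; omega)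
  rw [A, B]
  have h0 : pad z 0 = 0 := by
    funext k
    simp [pad]
  have hN : pad z (2 * K + 1) = z := by
    funext k
    have := k.2
    simp only [pad]
    rw [if_pos (by omega)]
  rw [h0, hN]
  ring
end
end
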